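/- Let L be a d-dimensional Lévy process with triplet (γ,0,ν) and L^ε its approximation obtained by removing jumps of size less than ε (with compensation for jumps in [ε,1]). If F(x) = f(e^{x_1},...,e^{x_d}) with f : ℝ_+^d → ℝ Lipschitz with constant C_f, and ∫_{|z|>1} e^{2a|z|} ν(dz) < ∞ for some a > 1, then there exists C > 0, independent of ε, such that |E[F(L_T)] - E[F(L_T^ε)]| ≤ C σ(ε), where σ²(ε) = ∫_{|x|≤ε} |x|² ν(dx). -/

import Mathlib

open MeasureTheory ProbabilityTheory
open scoped RealInnerProductSpace ENNReal NNReal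

section CompoundPoisson

variable {E : Type*} [AddMonoid E] [MeasurableSpace E] [MeasurableAdd₂ E]

lemma integrable_conv_of_map_add {𝕜 : Type*} [RCLike 𝕜] {h : E → 𝕜} (hm : Measurable h)
    (hadd : ∀ x y, h (x + y) = h x * h y) {μ ν : Measure E} [SFinite μ] [SFinite ν]
    (hμ : Integrable h μ) (hν : Integrable h ν) : Integrable h (μ.conv ν) := by
  unfold Measure.conv
  rw [integrable_map_measure hm.aestronglyMeasurable (by fun_prop)]
  refine (hμ.mul_prod hν).congr (.of_forall fun p ↦ ?_)
  simp [hadd]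

lemma integral_conv_of_map_add {𝕜 : Type*} [RCLike 𝕜] {h : E → 𝕜} (hm : Measurable h)
    (hadd : ∀ x y, h (x + y) = h x * h y) (μ ν : Measure E) [SFinite μ] [SFinite ν] :
    ∫ x, h x ∂(μ.conv ν) = (∫ x, h x ∂μ) * ∫ x, h x ∂ν := by
  unfold Measure.conv
  rw [integral_map (by fun_prop) hm.aestronglyMeasurable, ← integral_prod_mul]
  simp [hadd]

/-- The `n`-fold convolution power of a measure. -/
noncomputable def convPow (m : Measure E) : ℕ → Measure E
  | 0 => Measure.dirac 0
  | n + 1 => (convPow m n).conv m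

instance isFiniteMeasure_convPow (m : Measure E) [IsFiniteMeasure m] (n : ℕ) :
    IsFiniteMeasure (convPow m n) := by
  induction n with
  | zero => unfold convPow; infer_instance
  | succ n ih => unfold convPow; infer_instance

lemma integrable_convPow {𝕜 : Type*} [RCLike 𝕜] {h : E → 𝕜} (hm : Measurable h)
    (hadd : ∀ x y, h (x + y) = h x * h y) {m : Measure E} [IsFiniteMeasure m]
    (hi : Integrable h m) (n : ℕ) : Integrable h (convPow m n) := by
  induction n with
  | zero => exact integrable_dirac' hm.stronglyMeasurable (by simp)
  | succ n ih => exact integrable_conv_of_map_add hm hadd ih hi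

lemma integral_convPow {𝕜 : Type*} [RCLike 𝕜] {h : E → 𝕜} (hm : Measurable h)
    (hadd : ∀ x y, h (x + y) = h x * h y) (h0 : h 0 = 1) (m : Measure E) [IsFiniteMeasure m]
    (n : ℕ) : ∫ x, h x ∂(convPow m n) = (∫ x, h x ∂m) ^ n := by
  induction n with
  | zero => simp [convPow, integral_dirac' h 0 hm.stronglyMeasurable, h0]
  | succ n ih => rw [convPow, integral_conv_of_map_add hm hadd, ih, pow_succ]

/-- The compound Poisson distribution with (finite) jump measure `m`. -/
noncomputable def compoundPoisson (m : Measure E) : Measure E :=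
  ENNReal.ofReal (Real.exp (-m.real Set.univ)) •
    Measure.sum fun n : ℕ ↦ ENNReal.ofReal ((n.factorial : ℝ)⁻¹) • convPow m n

lemma integrable_compoundPoisson_aux {h : E → ℂ} (hm : Measurable h)
    (hadd : ∀ x y, h (x + y) = h x * h y) (h0 : h 0 = 1) {m : Measure E} [IsFiniteMeasure m]
    (hi : Integrable h m) :
    Integrable h (Measure.sum fun n : ℕ ↦ ENNReal.ofReal ((n.factorial : ℝ)⁻¹) • convPow m n) := by
  refine integrable_sum_measure
    (fun n ↦ (integrable_convPow hm hadd hi n).smul_measure (by simp)) ?_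
  have key (n : ℕ) : ∫ x, ‖h x‖ ∂(ENNReal.ofReal ((n.factorial : ℝ)⁻¹) • convPow m n)
      = (∫ x, ‖h x‖ ∂m) ^ n / n.factorial := by
    rw [integral_smul_measure, integral_convPow (h := fun x ↦ ‖h x‖) hm.norm
      (by simp [hadd]) (by simp [h0]), ENNReal.toReal_ofReal (by positivity), smul_eq_mul]
    ring
  simp_rw [key]
  exact Real.summable_pow_div_factorial _

lemma integrable_compoundPoisson {h : E → ℂ} (hm : Measurable h)
    (hadd : ∀ x y, h (x + y) = h x * h y) (h0 : h 0 = 1) {m : Measure E} [IsFiniteMeasure m]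
    (hi : Integrable h m) : Integrable h (compoundPoisson m) :=
  (integrable_compoundPoisson_aux hm hadd h0 hi).smul_measure (by simp)

lemma integral_compoundPoisson {h : E → ℂ} (hm : Measurable h)
    (hadd : ∀ x y, h (x + y) = h x * h y) (h0 : h 0 = 1) {m : Measure E} [IsFiniteMeasure m]
    (hi : Integrable h m) :
    ∫ x, h x ∂(compoundPoisson m) = Complex.exp (∫ x, (h x - 1) ∂m) := by
  rw [compoundPoisson, integral_smul_measure,
    integral_sum_measure (integrable_compoundPoisson_aux hm hadd h0 hi)]
  have key (n : ℕ) : ∫ x, h x ∂(ENNReal.ofReal ((n.factorial : ℝ)⁻¹) • convPow m n)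
      = (∫ x, h x ∂m) ^ n / n.factorial := by
    rw [integral_smul_measure, integral_convPow hm hadd h0, ENNReal.toReal_ofReal (by positivity),
      Complex.real_smul]
    push_cast
    ring
  simp_rw [key]
  rw [integral_sub hi (integrable_const _), Complex.exp_sub, integral_const,
    ENNReal.toReal_ofReal (by positivity), Complex.real_smul,
    congrFun Complex.exp_eq_exp_ℂ (∫ x, h x ∂m), NormedSpace.exp_eq_tsum_div]
  simp [Real.exp_neg, div_eq_mul_inv, mul_comm]

instance isProbabilityMeasure_compoundPoisson (m : Measure E) [IsFiniteMeasure m] :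
    IsProbabilityMeasure (compoundPoisson m) := by
  have h1 : Integrable (fun _ : E ↦ (1 : ℂ)) (compoundPoisson m) :=
    integrable_compoundPoisson measurable_const (by simp) rfl (integrable_const _)
  have hfin : IsFiniteMeasure (compoundPoisson m) := by
    simpa [integrable_const_iff] using h1
  have := integral_compoundPoisson (m := m) (h := fun _ ↦ 1) measurable_const (by simp) rfl
    (integrable_const _)
  simp only [integral_const, sub_self, smul_zero, Complex.exp_zero, Complex.real_smul, mul_one] at this
  exact isProbabilityMeasure_iff_real.2 (by exact_mod_cast this)

end CompoundPoisson

section SmallJumps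

variable {E : Type*} [NormedAddCommGroup E] [MeasurableSpace E] [BorelSpace E] {ν : Measure E}

lemma integrable_min_norm_sq (hν : ∫⁻ x, ENNReal.ofReal (min (‖x‖ ^ 2) 1) ∂ν < ∞) :
    Integrable (fun x ↦ min (‖x‖ ^ 2) 1) ν :=
  (lintegral_ofReal_ne_top_iff_integrable (by fun_prop)
    (.of_forall fun x ↦ by positivity)).1 hν.ne

lemma integrableOn_norm_sq (hν : ∫⁻ x, ENNReal.ofReal (min (‖x‖ ^ 2) 1) ∂ν < ∞) :
    IntegrableOn (fun x ↦ ‖x‖ ^ 2) {x | ‖x‖ ≤ 1} ν := by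
  refine ((integrable_min_norm_sq hν).integrableOn (s := {x | ‖x‖ ≤ 1})).congr_fun (fun x hx ↦ ?_)
    (measurableSet_le measurable_norm measurable_const)
  exact min_eq_left (pow_le_one₀ (norm_nonneg _) hx)

lemma measure_setOf_le_norm_lt_top (hν : ∫⁻ x, ENNReal.ofReal (min (‖x‖ ^ 2) 1) ∂ν < ∞)
    {δ : ℝ} (hδ : 0 < δ) : ν {x | δ ≤ ‖x‖} < ∞ := by
  refine (measure_mono (t := {x | min (δ ^ 2) 1 ≤ min (‖x‖ ^ 2) 1}) fun x hx ↦ ?_).trans_lt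
    ((integrable_min_norm_sq hν).measure_ge_lt_top (by positivity))
  simp only [Set.mem_ofPred_eq] at hx ⊢
  gcongr

end SmallJumps

section LevyKhintchine

variable {E : Type*} [NormedAddCommGroup E] [InnerProductSpace ℝ E]

/-- The integrand `e^{z⟪w,x⟫} - 1 - z⟪w,x⟫ 1_{‖x‖ ≤ 1}` of the Lévy-Khintchine exponent. -/
noncomputable def levyIntegrand (z : ℂ) (w x : E) : ℂ :=
  Complex.exp (z * ((⟪w, x⟫ : ℝ) : ℂ)) - 1 - z * ((⟪w, x⟫ : ℝ) : ℂ) *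
    Set.indicator {x | ‖x‖ ≤ 1} (fun _ => (1 : ℂ)) x

lemma levyIntegrand_of_le {z : ℂ} {w x : E} (hx : ‖x‖ ≤ 1) :
    levyIntegrand z w x =
      Complex.exp (z * ((⟪w, x⟫ : ℝ) : ℂ)) - 1 - z * ((⟪w, x⟫ : ℝ) : ℂ) := by
  simp [levyIntegrand, hx]

lemma levyIntegrand_of_lt {z : ℂ} {w x : E} (hx : 1 < ‖x‖) :
    levyIntegrand z w x = Complex.exp (z * ((⟪w, x⟫ : ℝ) : ℂ)) - 1 := by
  simp [levyIntegrand, hx]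

lemma norm_levyIntegrand_le {z : ℂ} (hz : ‖z‖ ≤ 1) {w x : E} (hx : ‖x‖ ≤ 1) :
    ‖levyIntegrand z w x‖ ≤ ‖w‖ ^ 2 * Real.exp ‖w‖ * ‖x‖ ^ 2 := by
  rw [levyIntegrand_of_le hx]
  have h := Complex.norm_exp_sub_sum_le_norm_mul_exp (z * ((⟪w, x⟫ : ℝ) : ℂ)) 2
  simp only [Finset.sum_range_succ, Finset.sum_range_zero, pow_zero, Nat.factorial, Nat.cast_one,
    zero_add, pow_one, div_one, mul_one, ← sub_sub] at h
  have h1 : ‖z * ((⟪w, x⟫ : ℝ) : ℂ)‖ ≤ ‖w‖ * ‖x‖ := by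
    rw [norm_mul, Complex.norm_real]
    have := norm_inner_le_norm (𝕜 := ℝ) w x
    nlinarith [norm_nonneg z, norm_nonneg (⟪w, x⟫ : ℝ)]
  have h2 : ‖z * ((⟪w, x⟫ : ℝ) : ℂ)‖ ≤ ‖w‖ := h1.trans (mul_le_of_le_one_right (norm_nonneg _) hx)
  calc _ ≤ _ := h
    _ ≤ (‖w‖ * ‖x‖) ^ 2 * Real.exp ‖w‖ := by gcongr
    _ = _ := by ring

variable [MeasurableSpace E] [BorelSpace E]

@[fun_prop]
lemma measurable_levyIntegrand (z : ℂ) (w : E) : Measurable (levyIntegrand z w) := by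
  have : Measurable (Set.indicator {x : E | ‖x‖ ≤ 1} (fun _ => (1 : ℂ))) :=
    measurable_const.indicator (measurableSet_le measurable_norm measurable_const)
  have h1 : Measurable fun x : E ↦ ((⟪w, x⟫ : ℝ) : ℂ) := by
    have : Continuous fun x : E ↦ ((⟪w, x⟫ : ℝ) : ℂ) := by fun_prop
    exact this.measurable
  unfold levyIntegrand
  fun_prop

variable {ν : Measure E}

lemma integrable_levyIntegrand (hν : ∫⁻ x, ENNReal.ofReal (min (‖x‖ ^ 2) 1) ∂ν < ∞)
    {z : ℂ} (hz : ‖z‖ ≤ 1) {w : E}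
    (hi : IntegrableOn (fun x ↦ Complex.exp (z * ((⟪w, x⟫ : ℝ) : ℂ))) {x | 1 < ‖x‖} ν) :
    Integrable (levyIntegrand z w) ν := by
  have hs : MeasurableSet {x : E | ‖x‖ ≤ 1} := measurableSet_le measurable_norm measurable_const
  have hc : {x : E | ‖x‖ ≤ 1}ᶜ = {x | 1 < ‖x‖} := by ext; simp
  rw [← integrableOn_univ, ← Set.union_compl_self {x : E | ‖x‖ ≤ 1}, hc]
  refine IntegrableOn.union ?_ ?_
  · refine ((integrableOn_norm_sq hν).const_mul (‖w‖ ^ 2 * Real.exp ‖w‖)).mono'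
      (by fun_prop) ?_
    filter_upwards [ae_restrict_mem hs] with x hx using norm_levyIntegrand_le hz hx
  · have : IntegrableOn (fun _ : E ↦ (1 : ℂ)) {x | 1 < ‖x‖} ν := by
      refine integrableOn_const ?_ (by simp)
      exact ((measure_mono fun x (hx : 1 < ‖x‖) ↦ hx.le).trans_lt
        (measure_setOf_le_norm_lt_top hν one_pos)).ne
    refine (hi.sub this).congr_fun (fun x hx ↦ ?_) (hc ▸ hs.compl)
    exact (levyIntegrand_of_lt hx).symm

/-- Existence of an infinitely divisible law with finite Lévy measure `T • ν.restrict A`, together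
with its (complex) exponential moments. -/
lemma exists_levy_law [SecondCountableTopology E] [CompleteSpace E]
    (hν : ∫⁻ x, ENNReal.ofReal (min (‖x‖ ^ 2) 1) ∂ν < ∞)
    (γ : E) {T : ℝ} (hT : 0 ≤ T) {A : Set E} {δ : ℝ} (hδ : 0 < δ)
    (hAδ : A ⊆ {x | δ ≤ ‖x‖}) :
    ∃ ρ : Measure E, IsProbabilityMeasure ρ ∧ ∀ (z : ℂ) (w : E), ‖z‖ ≤ 1 →
      IntegrableOn (fun x ↦ Complex.exp (z * ((⟪w, x⟫ : ℝ) : ℂ))) {x | 1 < ‖x‖} ν →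
      Integrable (fun x ↦ Complex.exp (z * ((⟪w, x⟫ : ℝ) : ℂ))) ρ ∧
      ∫ x, Complex.exp (z * ((⟪w, x⟫ : ℝ) : ℂ)) ∂ρ =
        Complex.exp (T * (z * ((⟪γ, w⟫ : ℝ) : ℂ) + ∫ x in A, levyIntegrand z w x ∂ν)) := by
  have hs : MeasurableSet {x : E | ‖x‖ ≤ 1} := measurableSet_le measurable_norm measurable_const
  have hAfin : IsFiniteMeasure (ν.restrict A) :=
    ⟨by simpa using (measure_mono hAδ).trans_lt (measure_setOf_le_norm_lt_top hν hδ)⟩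
  let D : E → E := Set.indicator {x | ‖x‖ ≤ 1} id
  have hD : Integrable D (ν.restrict A) := by
    refine (integrable_const (1 : ℝ)).mono' (measurable_id.indicator hs).aestronglyMeasurable
      (.of_forall fun x ↦ ?_)
    by_cases hx : ‖x‖ ≤ 1 <;> simp [D, hx]
  let c : E := T • (γ - ∫ x in A, D x ∂ν)
  let m : Measure E := T.toNNReal • ν.restrict A
  refine ⟨(compoundPoisson m).conv (Measure.dirac c), inferInstance, fun z w hz hi ↦ ?_⟩
  set h : E → ℂ := fun x ↦ Complex.exp (z * ((⟪w, x⟫ : ℝ) : ℂ)) with hdef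
  have hm : Measurable h := by
    have : Continuous h := by fun_prop
    exact this.measurable
  have hadd (x y : E) : h (x + y) = h x * h y := by
    simp only [hdef, ← Complex.exp_add, inner_add_right, Complex.ofReal_add, mul_add]
  have h0 : h 0 = 1 := by simp [hdef]
  have hlevy : Integrable (levyIntegrand z w) (ν.restrict A) :=
    (integrable_levyIntegrand hν hz hi).restrict
  have hwD : Integrable (fun x ↦ z * ((⟪w, D x⟫ : ℝ) : ℂ)) (ν.restrict A) :=
    ((hD.const_inner w).ofReal).const_mul z
  have heq (x : E) : h x - 1 = levyIntegrand z w x + z * ((⟪w, D x⟫ : ℝ) : ℂ) := by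
    by_cases hx : ‖x‖ ≤ 1
    · simp [hdef, levyIntegrand_of_le hx, D, hx]
    · rw [levyIntegrand_of_lt (not_le.1 hx)]
      simp [hdef, D, hx]
  have hhA : Integrable h (ν.restrict A) := by
    have := (hlevy.add hwD).add (integrable_const (1 : ℂ))
    refine this.congr (.of_forall fun x ↦ ?_)
    simp only [Pi.add_apply, ← heq]
    ring
  have hhm : Integrable h m := hhA.smul_measure_nnreal
  have hdirac : Integrable h (Measure.dirac c) := integrable_dirac (by simp)
  refine ⟨integrable_conv_of_map_add hm hadd
    (integrable_compoundPoisson hm hadd h0 hhm) hdirac, ?_⟩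
  rw [integral_conv_of_map_add hm hadd, integral_compoundPoisson hm hadd h0 hhm, integral_dirac,
    ← Complex.exp_add]
  congr 1
  have e1 : ∫ x, (h x - 1) ∂m = T * ∫ x in A, (h x - 1) ∂ν := by
    simp only [m]
    rw [integral_smul_nnreal_measure, NNReal.smul_def, Real.coe_toNNReal _ hT, Complex.real_smul]
  rw [e1]
  simp_rw [heq]
  rw [integral_add hlevy hwD, integral_const_mul, integral_complex_ofReal,
    integral_inner hD]
  simp only [c, inner_smul_right, inner_sub_right, real_inner_comm γ w]
  push_cast
  ring

end LevyKhintchine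

section ExponentialMoments

variable {E : Type*} [NormedAddCommGroup E] [InnerProductSpace ℝ E]

/-- The real integrand `e^{⟪w,x⟫} - 1 - ⟪w,x⟫ 1_{‖x‖ ≤ 1}` of the Lévy exponent. -/
noncomputable def levyExpIntegrand (w x : E) : ℝ :=
  Real.exp ⟪w, x⟫ - 1 - ⟪w, x⟫ * Set.indicator {x | ‖x‖ ≤ 1} (fun _ => (1 : ℝ)) x

lemma levyIntegrand_one (w x : E) : levyIntegrand 1 w x = (levyExpIntegrand w x : ℂ) := by
  by_cases hx : ‖x‖ ≤ 1 <;> simp [levyIntegrand, levyExpIntegrand, hx]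

lemma levyExpIntegrand_nonneg {w x : E} (hx : ‖x‖ ≤ 1) : 0 ≤ levyExpIntegrand w x := by
  have := Real.add_one_le_exp (⟪w, x⟫ : ℝ)
  simp only [levyExpIntegrand, Set.mem_ofPred_eq, hx, Set.indicator_of_mem, mul_one]
  linarith

lemma abs_levyExpIntegrand_le_of_le {w x : E} (hx : ‖x‖ ≤ 1) :
    |levyExpIntegrand w x| ≤ ‖w‖ ^ 2 * Real.exp ‖w‖ * ‖x‖ ^ 2 := by
  simpa [levyIntegrand_one] using norm_levyIntegrand_le (z := 1) (by simp) (w := w) hx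

lemma abs_levyExpIntegrand_le_of_lt {w x : E} (hw : ‖w‖ ≤ 2) (hx : 1 < ‖x‖) :
    |levyExpIntegrand w x| ≤ Real.exp (2 * ‖x‖) := by
  have h1 : (⟪w, x⟫ : ℝ) ≤ 2 * ‖x‖ := (real_inner_le_norm w x).trans (by gcongr)
  have h2 := Real.exp_le_exp.2 h1
  have h3 : 1 ≤ Real.exp (2 * ‖x‖) := Real.one_le_exp (by positivity)
  have h4 := Real.exp_pos (⟪w, x⟫ : ℝ)
  have h5 : levyExpIntegrand w x = Real.exp ⟪w, x⟫ - 1 := by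
    simp [levyExpIntegrand, hx]
  rw [h5, abs_le]
  constructor <;> linarith

variable [MeasurableSpace E] [BorelSpace E] {ν : Measure E}

lemma integrableOn_cexp_I_mul_inner (hν : ∫⁻ x, ENNReal.ofReal (min (‖x‖ ^ 2) 1) ∂ν < ∞) (u : E) :
    IntegrableOn (fun x ↦ Complex.exp (Complex.I * ((⟪u, x⟫ : ℝ) : ℂ))) {x | 1 < ‖x‖} ν := by
  have hc : Continuous fun x : E ↦ Complex.exp (Complex.I * ((⟪u, x⟫ : ℝ) : ℂ)) := by fun_prop
  have hfin : IntegrableOn (fun _ : E ↦ (1 : ℝ)) {x | 1 < ‖x‖} ν :=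
    integrableOn_const ((measure_mono fun x (hx : 1 < ‖x‖) ↦ hx.le).trans_lt
      (measure_setOf_le_norm_lt_top hν one_pos)).ne (by simp)
  refine hfin.mono' hc.measurable.aestronglyMeasurable (.of_forall fun x ↦ ?_)
  simp [Complex.norm_exp]

lemma integrable_levyIntegrand_I (hν : ∫⁻ x, ENNReal.ofReal (min (‖x‖ ^ 2) 1) ∂ν < ∞) (u : E) :
    Integrable (levyIntegrand Complex.I u) ν :=
  integrable_levyIntegrand hν (by simp) (integrableOn_cexp_I_mul_inner hν u)

lemma integrableOn_exp_inner
    (hexp : IntegrableOn (fun x ↦ Real.exp (2 * ‖x‖)) {x | 1 < ‖x‖} ν) {w : E} (hw : ‖w‖ ≤ 2) :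
    IntegrableOn (fun x ↦ Real.exp ⟪w, x⟫) {x | 1 < ‖x‖} ν := by
  have hc : Continuous fun x : E ↦ Real.exp ⟪w, x⟫ := by fun_prop
  refine hexp.mono' hc.measurable.aestronglyMeasurable (.of_forall fun x ↦ ?_)
  rw [Real.norm_eq_abs, Real.abs_exp]
  gcongr
  exact (real_inner_le_norm w x).trans (by gcongr)

lemma exists_setIntegral_levyExpIntegrand_le
    (hν : ∫⁻ x, ENNReal.ofReal (min (‖x‖ ^ 2) 1) ∂ν < ∞)
    (hexp : IntegrableOn (fun x ↦ Real.exp (2 * ‖x‖)) {x | 1 < ‖x‖} ν) :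
    ∃ K, 0 ≤ K ∧ ∀ w : E, ‖w‖ ≤ 2 → ∀ A, |∫ x in A, levyExpIntegrand w x ∂ν| ≤ K := by
  have hs : MeasurableSet {x : E | ‖x‖ ≤ 1} := measurableSet_le measurable_norm measurable_const
  have hs' : MeasurableSet {x : E | 1 < ‖x‖} := measurableSet_lt measurable_const measurable_norm
  let B : E → ℝ := fun x ↦
    Set.indicator {x | ‖x‖ ≤ 1} (fun x ↦ 2 ^ 2 * Real.exp 2 * ‖x‖ ^ 2) x +
    Set.indicator {x | 1 < ‖x‖} (fun x ↦ Real.exp (2 * ‖x‖)) x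
  have hB : Integrable B ν :=
    ((integrable_indicator_iff hs).2 ((integrableOn_norm_sq hν).const_mul _)).add
      (hexp.integrable_indicator hs')
  have hB0 (x : E) : 0 ≤ B x :=
    add_nonneg (Set.indicator_nonneg (fun _ _ ↦ by positivity) _)
      (Set.indicator_nonneg (fun _ _ ↦ by positivity) _)
  refine ⟨∫ x, B x ∂ν, integral_nonneg hB0, fun w hw A ↦ ?_⟩
  calc |∫ x in A, levyExpIntegrand w x ∂ν| ≤ ∫ x in A, B x ∂ν := by
        refine norm_integral_le_of_norm_le (f := levyExpIntegrand w) hB.restrict (.of_forall fun x ↦ ?_)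
        by_cases hx : ‖x‖ ≤ 1
        · simp only [B, Set.mem_ofPred_eq, hx, Set.indicator_of_mem, not_lt.2 hx,
            not_false_eq_true, Set.indicator_of_notMem, add_zero]
          exact (abs_levyExpIntegrand_le_of_le hx).trans (by gcongr)
        · simp only [B, Set.mem_ofPred_eq, hx, not_le.1 hx, Set.indicator_of_mem,
            not_false_eq_true, Set.indicator_of_notMem, zero_add]
          exact abs_levyExpIntegrand_le_of_lt hw (not_le.1 hx)
    _ ≤ ∫ x, B x ∂ν := setIntegral_le_integral hB (.of_forall hB0)

lemma setIntegral_levyExpIntegrand_le_of_subset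
    (hν : ∫⁻ x, ENNReal.ofReal (min (‖x‖ ^ 2) 1) ∂ν < ∞)
    {w : E} (hw : ‖w‖ ≤ 2) {ε : ℝ} (hε : ε ≤ 1) {A : Set E} (hA : MeasurableSet A)
    (hAε : A ⊆ {x | ‖x‖ ≤ ε}) :
    ∫ x in A, levyExpIntegrand w x ∂ν ≤
      2 ^ 2 * Real.exp 2 * ∫ x in {x | ‖x‖ ≤ ε}, ‖x‖ ^ 2 ∂ν := by
  have hI : IntegrableOn (fun x ↦ 2 ^ 2 * Real.exp 2 * ‖x‖ ^ 2) {x : E | ‖x‖ ≤ ε} ν :=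
    ((integrableOn_norm_sq hν).mono_set fun x (hx : ‖x‖ ≤ ε) ↦ hx.trans hε).const_mul _
  rw [← integral_const_mul]
  calc ∫ x in A, levyExpIntegrand w x ∂ν
      ≤ ∫ x in A, 2 ^ 2 * Real.exp 2 * ‖x‖ ^ 2 ∂ν := by
        refine (le_abs_self _).trans
          (norm_integral_le_of_norm_le (f := levyExpIntegrand w) (hI.mono_set hAε) ?_)
        filter_upwards [ae_restrict_mem hA] with x hx
        exact (abs_levyExpIntegrand_le_of_le ((hAε hx).trans hε)).trans (by gcongr)
    _ ≤ _ := setIntegral_mono_set hI (.of_forall fun x ↦ by positivity) hAε.eventuallyLE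

/-- Existence of an infinitely divisible law with finite Lévy measure `T • ν.restrict A`, together
with its characteristic function and real exponential moments. -/
lemma exists_levy_law_charFun [SecondCountableTopology E] [CompleteSpace E]
    (hν : ∫⁻ x, ENNReal.ofReal (min (‖x‖ ^ 2) 1) ∂ν < ∞)
    (hexp : IntegrableOn (fun x ↦ Real.exp (2 * ‖x‖)) {x | 1 < ‖x‖} ν)
    (γ : E) {T : ℝ} (hT : 0 ≤ T) {A : Set E} {δ : ℝ} (hδ : 0 < δ) (hAδ : A ⊆ {x | δ ≤ ‖x‖}) :
    ∃ ρ : Measure E, IsProbabilityMeasure ρ ∧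
      (∀ u : E, charFun ρ u = Complex.exp (T * (Complex.I * ((⟪γ, u⟫ : ℝ) : ℂ) +
        ∫ x in A, levyIntegrand Complex.I u x ∂ν))) ∧
      ∀ w : E, ‖w‖ ≤ 2 → Integrable (fun x ↦ Real.exp ⟪w, x⟫) ρ ∧
        ∫ x, Real.exp ⟪w, x⟫ ∂ρ =
          Real.exp (T * (⟪γ, w⟫ + ∫ x in A, levyExpIntegrand w x ∂ν)) := by
  obtain ⟨ρ, hρ, h⟩ := exists_levy_law hν γ hT hδ hAδ
  refine ⟨ρ, hρ, fun u ↦ ?_, fun w hw ↦ ?_⟩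
  · rw [← (h Complex.I u (by simp) (integrableOn_cexp_I_mul_inner hν u)).2, charFun_apply]
    simp_rw [real_inner_comm u, mul_comm Complex.I]
  · obtain ⟨h1, h2⟩ := h 1 w (by simp) (by
      simpa [IntegrableOn] using Integrable.ofReal (𝕜 := ℂ) (integrableOn_exp_inner hexp hw))
    constructor
    · convert h1.re using 2 with x
      simp [← Complex.ofReal_exp]
    · simp only [one_mul, levyIntegrand_one, ← Complex.ofReal_exp, integral_complex_ofReal] at h2
      exact_mod_cast h2

end ExponentialMoments

section WeakLimits

open Filter Topology BoundedContinuousFunction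

variable {E : Type*} [TopologicalSpace E]

/-- The truncation of a continuous function to the interval `[-R, R]`. -/
noncomputable def clamp {F : E → ℝ} (hF : Continuous F) (R : ℕ) : E →ᵇ ℝ :=
  BoundedContinuousFunction.ofNormedAddCommGroup (fun x ↦ max (-(R : ℝ)) (min R (F x)))
    (by fun_prop) R (fun x ↦ by
      have hR : (0 : ℝ) ≤ R := by positivity
      rw [Real.norm_eq_abs, abs_le]
      exact ⟨le_max_left _ _, max_le (by linarith) (min_le_left _ _)⟩)

lemma clamp_apply {F : E → ℝ} (hF : Continuous F) (R : ℕ) (x : E) :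
    clamp hF R x = max (-(R : ℝ)) (min R (F x)) := rfl

lemma abs_clamp_sub_clamp_le {F : E → ℝ} (hF : Continuous F) (R : ℕ) (x y : E) :
    |clamp hF R x - clamp hF R y| ≤ |F x - F y| := by
  simp only [clamp_apply]
  refine (abs_max_sub_max_le_max _ _ _ _).trans ?_
  simp only [sub_self, abs_zero]
  refine max_le (abs_nonneg _) ((abs_min_sub_min_le_max _ _ _ _).trans ?_)
  simp

lemma abs_clamp_le_natCast {F : E → ℝ} (hF : Continuous F) (R : ℕ) (x : E) :
    |clamp hF R x| ≤ R := by
  have hR : (0 : ℝ) ≤ R := by positivity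
  rw [clamp_apply, abs_le]
  exact ⟨le_max_left _ _, max_le (by linarith) (min_le_left _ _)⟩

lemma abs_clamp_le {F : E → ℝ} (hF : Continuous F) (R : ℕ) (x : E) :
    |clamp hF R x| ≤ |F x| := by
  have hR : (0 : ℝ) ≤ R := by positivity
  rw [clamp_apply, abs_le]
  rcases abs_cases (F x) with h | h <;> constructor <;> grind

variable [MeasurableSpace E] [BorelSpace E]

lemma tendsto_integral_clamp {F : E → ℝ} (hF : Continuous F) {μ : Measure E}
    (hi : Integrable F μ) :
    Tendsto (fun R : ℕ ↦ ∫ x, clamp hF R x ∂μ) atTop (𝓝 (∫ x, F x ∂μ)) := by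
  refine tendsto_integral_of_dominated_convergence (fun x ↦ |F x|)
    (fun R ↦ (clamp hF R).continuous.measurable.aestronglyMeasurable) hi.abs
    (fun R ↦ .of_forall fun x ↦ abs_clamp_le hF R x) (.of_forall fun x ↦ ?_)
  refine tendsto_const_nhds.congr' ?_
  obtain ⟨N, hN⟩ := exists_nat_ge |F x|
  filter_upwards [eventually_ge_atTop N] with R hR
  have : |F x| ≤ R := hN.trans (by exact_mod_cast hR)
  rw [abs_le] at this
  rw [clamp_apply, min_eq_right this.2, max_eq_right this.1]

lemma integrable_of_tendsto_of_integral_le [HasOuterApproxClosed E] {μs : ℕ → ProbabilityMeasure E}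
    {μ : ProbabilityMeasure E} (hlim : Tendsto μs atTop (𝓝 μ)) {g : E → ℝ} (hg : Continuous g)
    (hg0 : 0 ≤ g) {M : ℝ} (hgi : ∀ n, Integrable g (μs n : Measure E))
    (hgM : ∀ n, ∫ x, g x ∂(μs n : Measure E) ≤ M) : Integrable g (μ : Measure E) := by
  rw [← lintegral_ofReal_ne_top_iff_integrable hg.measurable.aestronglyMeasurable
    (.of_forall hg0)]
  refine ne_top_of_le_ne_top (b := ENNReal.ofReal M) ENNReal.ofReal_ne_top
    ((lintegral_le_liminf_lintegral_of_forall_isOpen_measure_le_liminf_measure hg hg0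
      fun G hG ↦ ProbabilityMeasure.le_liminf_measure_open_of_tendsto hlim hG).trans ?_)
  refine liminf_le_of_le (by isBoundedDefault) fun b hb ↦ ?_
  obtain ⟨n, hn⟩ := hb.exists
  refine hn.trans ?_
  rw [← ofReal_integral_eq_lintegral_ofReal (hgi n) (.of_forall hg0)]
  exact ENNReal.ofReal_le_ofReal (hgM n)

lemma abs_integral_sub_integral_le_of_tendsto {μs : ℕ → ProbabilityMeasure E}
    {μ : ProbabilityMeasure E} (hlim : Tendsto μs atTop (𝓝 μ)) {μ' : Measure E} {F : E → ℝ}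
    (hF : Continuous F) (hi : Integrable F (μ : Measure E)) (hi' : Integrable F μ') {B : ℝ}
    (hB : ∀ R n, |∫ x, clamp hF R x ∂(μs n : Measure E) - ∫ x, clamp hF R x ∂μ'| ≤ B) :
    |∫ x, F x ∂(μ : Measure E) - ∫ x, F x ∂μ'| ≤ B := by
  refine le_of_tendsto ((tendsto_integral_clamp hF hi).sub (tendsto_integral_clamp hF hi')).abs
    (.of_forall fun R ↦ ?_)
  refine le_of_tendsto (((ProbabilityMeasure.tendsto_iff_forall_integral_tendsto.1 hlim
    (clamp hF R)).sub_const _).abs) (.of_forall fun n ↦ hB R n)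

end WeakLimits

section Measurability

open Filter Topology

lemma tendsto_mul_sin_div (y : ℝ) :
    Tendsto (fun n : ℕ ↦ (n + 1 : ℝ) * Real.sin (1 / (n + 1 : ℝ) * y)) atTop (𝓝 y) := by
  have h1 : Tendsto (fun n : ℕ ↦ 1 / (n + 1 : ℝ) * y) atTop (𝓝 0) := by
    simpa using tendsto_one_div_add_atTop_nhds_zero_nat.mul_const y
  have h2 := ((Real.continuous_sinc.tendsto 0).comp h1).const_mul y
  rw [Real.sinc_zero, mul_one] at h2
  refine h2.congr fun n ↦ ?_
  have hn : (n + 1 : ℝ) ≠ 0 := by positivity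
  rcases eq_or_ne y 0 with rfl | hy
  · simp
  · simp only [Function.comp_apply]
    rw [Real.sinc_of_ne_zero (by positivity)]
    field_simp

lemma aemeasurable_of_integral_exp_ne_zero {Ω : Type*} [MeasurableSpace Ω] {P : Measure Ω} {d : ℕ}
    {X : Ω → EuclideanSpace ℝ (Fin d)}
    (h : ∀ u, ∫ ω, Complex.exp (Complex.I * ((⟪u, X ω⟫ : ℝ) : ℂ)) ∂P ≠ 0) : AEMeasurable X P := by
  have hsin (u : EuclideanSpace ℝ (Fin d)) : AEMeasurable (fun ω ↦ Real.sin ⟪u, X ω⟫) P := by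
    have h1 : Integrable (fun ω ↦ Complex.exp (Complex.I * ((⟪u, X ω⟫ : ℝ) : ℂ))) P :=
      not_imp_comm.1 integral_undef (h u)
    refine (Complex.measurable_im.comp_aemeasurable h1.aemeasurable).congr (.of_forall fun ω ↦ ?_)
    simp [mul_comm Complex.I, Complex.exp_ofReal_mul_I_im]
  have hcoord (j : Fin d) : AEMeasurable (fun ω ↦ X ω j) P := by
    refine aemeasurable_of_tendsto_metrizable_ae atTop
      (f := fun (n : ℕ) ω ↦ (n + 1 : ℝ) * Real.sin (1 / (n + 1 : ℝ) * X ω j)) (fun n ↦ ?_)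
      (.of_forall fun ω ↦ tendsto_mul_sin_div _)
    refine ((hsin (EuclideanSpace.single j (1 / (n + 1 : ℝ)))).const_mul (n + 1 : ℝ)).congr
      (.of_forall fun ω ↦ ?_)
    simp [EuclideanSpace.inner_single_left]
  have := (WithLp.measurable_toLp 2 (Fin d → ℝ)).comp_aemeasurable (aemeasurable_pi_lambda _ hcoord)
  exact this

end Measurability

section Increment

lemma integral_abs_le_sqrt {α : Type*} [MeasurableSpace α] {ρ : Measure α}
    [IsProbabilityMeasure ρ] {Z : α → ℝ}
    (hZ : Integrable Z ρ) (hZ2 : Integrable (fun y ↦ Z y ^ 2) ρ) :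
    ∫ y, |Z y| ∂ρ ≤ Real.sqrt (∫ y, Z y ^ 2 ∂ρ) := by
  refine Real.le_sqrt_of_sq_le ?_
  set c := ∫ y, |Z y| ∂ρ with hc
  have h0 : 0 ≤ ∫ y, (|Z y| - c) ^ 2 ∂ρ := integral_nonneg fun y ↦ sq_nonneg _
  have h1 : ∫ y, (|Z y| - c) ^ 2 ∂ρ = ∫ y, Z y ^ 2 ∂ρ - 2 * c * c + c ^ 2 := by
    have (y : α) : (|Z y| - c) ^ 2 = Z y ^ 2 - 2 * c * |Z y| + c ^ 2 := by
      rw [sub_sq, sq_abs]; ring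
    simp_rw [this]
    have hi : Integrable (fun y ↦ Z y ^ 2 - 2 * c * |Z y|) ρ := hZ2.sub (hZ.abs.const_mul _)
    rw [integral_add hi (integrable_const _), integral_sub hZ2 (hZ.abs.const_mul _), integral_const_mul]
    simp [hc]
  nlinarith

lemma integral_abs_exp_sub_one_le {α : Type*} [MeasurableSpace α] {ρ : Measure α}
    [IsProbabilityMeasure ρ] {Y : α → ℝ} {S : ℝ}
    (h1 : Integrable (fun y ↦ Real.exp (Y y)) ρ) (h2 : Integrable (fun y ↦ Real.exp (2 * Y y)) ρ)
    (hge : 1 ≤ ∫ y, Real.exp (Y y) ∂ρ) (hle : ∫ y, Real.exp (2 * Y y) ∂ρ ≤ Real.exp S) :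
    ∫ y, |Real.exp (Y y) - 1| ∂ρ ≤ Real.sqrt (S * Real.exp S) := by
  have hsq (y : α) : (Real.exp (Y y) - 1) ^ 2 = Real.exp (2 * Y y) - 2 * Real.exp (Y y) + 1 := by
    rw [two_mul, Real.exp_add]; ring
  have hi : Integrable (fun y ↦ Real.exp (2 * Y y) - 2 * Real.exp (Y y)) ρ :=
    h2.sub (h1.const_mul 2)
  have hi' : Integrable (fun y ↦ Real.exp (Y y) - 1) ρ := h1.sub (integrable_const _)
  have hi2 : Integrable (fun y ↦ (Real.exp (Y y) - 1) ^ 2) ρ := by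
    simp_rw [hsq]
    exact hi.add (integrable_const _)
  refine (integral_abs_le_sqrt hi' hi2).trans (Real.sqrt_le_sqrt ?_)
  simp_rw [hsq]
  rw [integral_add hi (integrable_const _), integral_sub h2 (h1.const_mul 2), integral_const_mul]
  have h3 := Real.add_one_le_exp (-S)
  have h4 : Real.exp (-S) * Real.exp S = 1 := by rw [← Real.exp_add]; simp
  have h5 := Real.exp_pos S
  simp
  nlinarith

lemma abs_integral_conv_sub_le {E : Type*} [AddMonoid E] [MeasurableSpace E] [MeasurableAdd₂ E]
    {ι : Type*} [Fintype ι] {μ ρ : Measure E} [IsProbabilityMeasure μ]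
    [IsProbabilityMeasure ρ] {G : E → ℝ} (hG : Measurable G) {c : ℝ} (hb : ∀ x, |G x| ≤ c)
    {p q : ι → E → ℝ} (hp : ∀ j, Integrable (p j) μ) (hq : ∀ j, Integrable (q j) ρ)
    (h : ∀ x y, |G (x + y) - G x| ≤ ∑ j, p j x * q j y) :
    |∫ x, G x ∂(μ.conv ρ) - ∫ x, G x ∂μ| ≤ ∑ j, (∫ x, p j x ∂μ) * ∫ y, q j y ∂ρ := by
  have e1 : ∫ x, G x ∂(μ.conv ρ) = ∫ z, G (z.1 + z.2) ∂(μ.prod ρ) := by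
    unfold Measure.conv
    exact integral_map (by fun_prop) hG.aestronglyMeasurable
  have e2 : ∫ x, G x ∂μ = ∫ z, G z.1 ∂(μ.prod ρ) := by
    rw [integral_fun_fst]; simp
  have i1 : Integrable (fun z : E × E ↦ G (z.1 + z.2)) (μ.prod ρ) :=
    (integrable_const c).mono' (hG.comp (by fun_prop)).aestronglyMeasurable (.of_forall fun z ↦ hb _)
  have i2 : Integrable (fun z : E × E ↦ G z.1) (μ.prod ρ) :=
    (integrable_const c).mono' (hG.comp (by fun_prop)).aestronglyMeasurable (.of_forall fun z ↦ hb _)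
  rw [e1, e2, ← integral_sub i1 i2]
  simp_rw [← integral_prod_mul]
  rw [← integral_finsetSum _ fun j _ ↦ (hp j).mul_prod (hq j)]
  exact norm_integral_le_of_norm_le (f := fun z : E × E ↦ G (z.1 + z.2) - G z.1)
    (integrable_finsetSum _ fun j _ ↦ (hp j).mul_prod (hq j)) (.of_forall fun z ↦ h _ _)

end Increment

section ExponentialPayoff

variable {d : ℕ} {f : (Fin d → ℝ) → ℝ} {Cf : ℝ≥0}

lemma LipschitzWith.abs_sub_le_sum (hf : LipschitzWith Cf f) (a b : Fin d → ℝ) :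
    |f a - f b| ≤ Cf * ∑ j, |a j - b j| := by
  have h := hf.dist_le_mul a b
  rw [Real.dist_eq] at h
  refine h.trans ?_
  gcongr
  exact (dist_pi_le_iff (Finset.sum_nonneg fun _ _ ↦ abs_nonneg _)).2 fun j ↦
    Finset.single_le_sum (f := fun j ↦ |a j - b j|) (fun _ _ ↦ abs_nonneg _) (Finset.mem_univ j)

lemma continuous_expPayoff (hf : LipschitzWith Cf f) :
    Continuous fun x : EuclideanSpace ℝ (Fin d) ↦ f (fun j ↦ Real.exp (x j)) :=
  hf.continuous.comp (by fun_prop)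

lemma abs_expPayoff_add_sub_le (hf : LipschitzWith Cf f) (x y : EuclideanSpace ℝ (Fin d)) :
    |f (fun j ↦ Real.exp ((x + y) j)) - f (fun j ↦ Real.exp (x j))| ≤
      ∑ j, (Cf * Real.exp (x j)) * |Real.exp (y j) - 1| := by
  refine (hf.abs_sub_le_sum _ _).trans_eq ?_
  rw [Finset.mul_sum]
  refine Finset.sum_congr rfl fun j _ ↦ ?_
  rw [mul_assoc, ← Real.abs_exp (x j), ← abs_mul, Real.abs_exp, PiLp.add_apply, Real.exp_add]
  congr 2
  ring

lemma abs_expPayoff_le (hf : LipschitzWith Cf f) (x : EuclideanSpace ℝ (Fin d)) :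
    |f (fun j ↦ Real.exp (x j))| ≤ |f 0| + Cf * ∑ j, Real.exp (x j) := by
  have h := hf.abs_sub_le_sum (fun j ↦ Real.exp (x j)) 0
  simp only [Pi.zero_apply, sub_zero, Real.abs_exp] at h
  have := abs_sub_abs_le_abs_sub (f fun j ↦ Real.exp (x j)) (f 0)
  linarith

end ExponentialPayoff

section Laws

open Filter Topology

variable {d : ℕ} {ν : Measure (EuclideanSpace ℝ (Fin d))}

lemma charFun_map_eq_integral {Ω : Type*} [MeasurableSpace Ω] {P : Measure Ω}
    {X : Ω → EuclideanSpace ℝ (Fin d)} (hX : AEMeasurable X P) (u : EuclideanSpace ℝ (Fin d)) :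
    charFun (P.map X) u = ∫ ω, Complex.exp (Complex.I * ((⟪u, X ω⟫ : ℝ) : ℂ)) ∂P := by
  have hc : Continuous fun x : EuclideanSpace ℝ (Fin d) ↦
      Complex.exp (((⟪x, u⟫ : ℝ) : ℂ) * Complex.I) := by fun_prop
  rw [charFun_apply, integral_map hX hc.measurable.aestronglyMeasurable]
  simp_rw [real_inner_comm u, mul_comm Complex.I]

lemma tendsto_setIntegral_levyIntegrand
    (hν : ∫⁻ x, ENNReal.ofReal (min (‖x‖ ^ 2) 1) ∂ν < ∞) (u : EuclideanSpace ℝ (Fin d))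
    {δ : ℕ → ℝ} (hanti : Antitone δ) (hlim : Tendsto δ atTop (𝓝 0)) :
    Tendsto (fun n ↦ ∫ x in {x | δ n ≤ ‖x‖}, levyIntegrand Complex.I u x ∂ν) atTop
      (𝓝 (∫ x, levyIntegrand Complex.I u x ∂ν)) := by
  have h := tendsto_setIntegral_of_monotone (μ := ν) (f := levyIntegrand Complex.I u)
    (s := fun n ↦ {x | δ n ≤ ‖x‖}) (fun n ↦ measurableSet_le measurable_const measurable_norm)
    (fun m n hmn x hx ↦ (hanti hmn).trans hx) (integrable_levyIntegrand_I hν u).integrableOn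
  rwa [setIntegral_eq_integral_of_forall_compl_eq_zero] at h
  intro x hx
  simp only [Set.mem_iUnion, Set.mem_ofPred_eq, not_exists, not_le] at hx
  have hx0 : ‖x‖ ≤ 0 := ge_of_tendsto' hlim fun n ↦ (hx n).le
  simp [norm_le_zero_iff.1 hx0, levyIntegrand]

end Laws

/-- Weak error bound `|E F(L_T) - E F(L_T^ε)| ≤ C σ(ε)` for exponential Lévy payoffs
`F(x) = f(e^{x_1},…,e^{x_d})` with `f` Lipschitz, under the exponential moment condition
`∫_{|z|>1} e^{2a|z|} ν(dz) < ∞`, `a > 1`. -/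
theorem stmt_1 {d : ℕ}
    {Ω : Type*} [MeasureSpace Ω] [IsProbabilityMeasure (ℙ : Measure Ω)]
    (ν : Measure (EuclideanSpace ℝ (Fin d)))
    (hν : ∫⁻ x, ENNReal.ofReal (min (‖x‖ ^ 2) 1) ∂ν < ∞)
    (γ : EuclideanSpace ℝ (Fin d)) (T : ℝ) (hT : 0 < T)
    (L : Ω → EuclideanSpace ℝ (Fin d)) (Lε : ℝ → Ω → EuclideanSpace ℝ (Fin d))
    (hcharL : ∀ u : EuclideanSpace ℝ (Fin d),
      ∫ ω, Complex.exp (Complex.I * ((⟪u, L ω⟫ : ℝ) : ℂ)) =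
        Complex.exp ((T : ℂ) * (Complex.I * ((⟪γ, u⟫ : ℝ) : ℂ) +
          ∫ x, (Complex.exp (Complex.I * ((⟪u, x⟫ : ℝ) : ℂ)) - 1 -
            Complex.I * ((⟪u, x⟫ : ℝ) : ℂ) *
              Set.indicator {x | ‖x‖ ≤ 1} (fun _ => (1 : ℂ)) x) ∂ν)))
    (hcharLε : ∀ ε ∈ Set.Ioc (0 : ℝ) 1, ∀ u : EuclideanSpace ℝ (Fin d),
      ∫ ω, Complex.exp (Complex.I * ((⟪u, Lε ε ω⟫ : ℝ) : ℂ)) =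
        Complex.exp ((T : ℂ) * (Complex.I * ((⟪γ, u⟫ : ℝ) : ℂ) +
          ∫ x in {x | ε ≤ ‖x‖}, (Complex.exp (Complex.I * ((⟪u, x⟫ : ℝ) : ℂ)) - 1 -
            Complex.I * ((⟪u, x⟫ : ℝ) : ℂ) *
              Set.indicator {x | ‖x‖ ≤ 1} (fun _ => (1 : ℂ)) x) ∂ν)))
    (f : (Fin d → ℝ) → ℝ) (Cf : ℝ≥0) (hf : LipschitzWith Cf f)
    (a : ℝ) (ha : 1 < a)
    (hexp : ∫⁻ x in {x | 1 < ‖x‖}, ENNReal.ofReal (Real.exp (2 * a * ‖x‖)) ∂ν < ∞) :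
    ∃ C > 0, ∀ ε ∈ Set.Ioc (0 : ℝ) 1,
      |(∫ ω, f (fun j => Real.exp (L ω j))) - ∫ ω, f (fun j => Real.exp (Lε ε ω j))| ≤
        C * Real.sqrt (∫ x in {x | ‖x‖ ≤ ε}, ‖x‖ ^ 2 ∂ν) := by
  have hexp2 : IntegrableOn (fun x ↦ Real.exp (2 * ‖x‖)) {x | 1 < ‖x‖} ν := by
    have h : IntegrableOn (fun x ↦ Real.exp (2 * a * ‖x‖)) {x | 1 < ‖x‖} ν :=
      (lintegral_ofReal_ne_top_iff_integrable (by fun_prop)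
        (.of_forall fun x ↦ by positivity)).1 hexp.ne
    refine h.mono' (by fun_prop) (.of_forall fun x ↦ ?_)
    rw [Real.norm_eq_abs, Real.abs_exp]
    gcongr
    linarith
  obtain ⟨K, hK0, hK⟩ := exists_setIntegral_levyExpIntegrand_le hν hexp2
  have hmL : AEMeasurable L := aemeasurable_of_integral_exp_ne_zero fun u ↦ by
    rw [hcharL]; exact Complex.exp_ne_zero _
  have hmLε (ε : ℝ) (hε : ε ∈ Set.Ioc (0 : ℝ) 1) : AEMeasurable (Lε ε) :=
    aemeasurable_of_integral_exp_ne_zero fun u ↦ by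
      rw [hcharLε ε hε]; exact Complex.exp_ne_zero _
  set e : Fin d → EuclideanSpace ℝ (Fin d) := fun j ↦ EuclideanSpace.single j 1
  have he (j : Fin d) (x : EuclideanSpace ℝ (Fin d)) : ⟪e j, x⟫ = x j := by
    simp [e, EuclideanSpace.inner_single_left]
  have he2 (j : Fin d) (x : EuclideanSpace ℝ (Fin d)) : ⟪(2 : ℝ) • e j, x⟫ = 2 * x j := by
    rw [real_inner_smul_left, he]
  have hne (j : Fin d) : ‖e j‖ = 1 := by simp [e]
  have hne2 (j : Fin d) : ‖(2 : ℝ) • e j‖ ≤ 2 := by simp [norm_smul, hne]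
  let P : ℝ → Measure (EuclideanSpace ℝ (Fin d)) := fun ε ↦ Measure.map (Lε ε) ℙ
  have hP (ε : ℝ) (hε : ε ∈ Set.Ioc (0 : ℝ) 1) : IsProbabilityMeasure (P ε) :=
    Measure.isProbabilityMeasure_map (hmLε ε hε)
  have hcharP (ε : ℝ) (hε : ε ∈ Set.Ioc (0 : ℝ) 1) (u : EuclideanSpace ℝ (Fin d)) :
      charFun (P ε) u = Complex.exp (T * (Complex.I * ((⟪γ, u⟫ : ℝ) : ℂ) +
        ∫ x in {x | ε ≤ ‖x‖}, levyIntegrand Complex.I u x ∂ν)) :=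
    (charFun_map_eq_integral (hmLε ε hε) u).trans (hcharLε ε hε u)
  set M : ℝ := Real.exp (T * (‖γ‖ + K))
  have hmom (ε : ℝ) (hε : ε ∈ Set.Ioc (0 : ℝ) 1) (j : Fin d) :
      Integrable (fun x ↦ Real.exp (x j)) (P ε) ∧ ∫ x, Real.exp (x j) ∂(P ε) ≤ M := by
    obtain ⟨ρ, hρ, hc, hm⟩ := exists_levy_law_charFun hν hexp2 γ hT.le hε.1
      (subset_refl {x | ε ≤ ‖x‖})
    have := hP ε hε
    have hPρ : P ε = ρ := Measure.ext_of_charFun (funext fun u ↦ by rw [hc, hcharP ε hε])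
    obtain ⟨h1, h2⟩ := hm (e j) (by simp [hne])
    simp only [he] at h1 h2
    rw [hPρ]
    refine ⟨h1, h2.trans_le (Real.exp_le_exp.2 ?_)⟩
    gcongr
    · exact (real_inner_le_norm _ _).trans (by simp [hne])
    · exact (le_abs_self _).trans (hK _ (by simp [hne]) _)
  set F : EuclideanSpace ℝ (Fin d) → ℝ := fun x ↦ f (fun j ↦ Real.exp (x j))
  have hF : Continuous F := continuous_expPayoff hf
  let g : EuclideanSpace ℝ (Fin d) → ℝ := fun x ↦ |f 0| + Cf * ∑ j, Real.exp (x j)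
  have hg : Continuous g := by fun_prop
  have hg0 : 0 ≤ g := fun x ↦ by positivity
  have hgi (ε : ℝ) (hε : ε ∈ Set.Ioc (0 : ℝ) 1) : Integrable g (P ε) := by
    have := hP ε hε
    exact (integrable_const _).add
      ((integrable_finsetSum _ fun j _ ↦ (hmom ε hε j).1).const_mul _)
  have hgM (ε : ℝ) (hε : ε ∈ Set.Ioc (0 : ℝ) 1) :
      ∫ x, g x ∂(P ε) ≤ |f 0| + Cf * ∑ _j : Fin d, M := by
    have := hP ε hε
    have hs : Integrable (fun x ↦ ∑ j, Real.exp (x j)) (P ε) :=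
      integrable_finsetSum _ fun j _ ↦ (hmom ε hε j).1
    rw [integral_add (integrable_const _) (hs.const_mul _), integral_const_mul,
      integral_finsetSum _ fun j _ ↦ (hmom ε hε j).1]
    simp only [integral_const, probReal_univ, one_smul]
    gcongr with j
    exact (hmom ε hε j).2
  have hFi {μ : Measure (EuclideanSpace ℝ (Fin d))} (h : Integrable g μ) : Integrable F μ :=
    h.mono' hF.measurable.aestronglyMeasurable (.of_forall fun x ↦ abs_expPayoff_le hf x)
  set C₀ : ℝ := T * (2 ^ 2 * Real.exp 2) * Real.exp (T * K)
  refine ⟨Cf * d * M * Real.sqrt C₀ + 1, by positivity, fun ε hε ↦ ?_⟩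
  set σ2 : ℝ := ∫ x in {x | ‖x‖ ≤ ε}, ‖x‖ ^ 2 ∂ν
  have hσ2 : 0 ≤ σ2 := integral_nonneg fun x ↦ by positivity
  have hPε := hP ε hε
  -- comparison of the laws at levels `δ < ε`, uniformly in `δ`
  have hcompare (δ : ℝ) (hδ : δ ∈ Set.Ioc (0 : ℝ) 1) (hδε : δ ≤ ε) (R : ℕ) :
      |∫ x, clamp hF R x ∂(P δ) - ∫ x, clamp hF R x ∂(P ε)| ≤
        Cf * d * M * Real.sqrt C₀ * Real.sqrt σ2 := by
    have hPδ := hP δ hδ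
    set A : Set (EuclideanSpace ℝ (Fin d)) := {x | δ ≤ ‖x‖ ∧ ‖x‖ < ε}
    have hA : MeasurableSet A := (measurableSet_le measurable_const measurable_norm).inter
      (measurableSet_lt measurable_norm measurable_const)
    have hAε : A ⊆ {x | ‖x‖ ≤ ε} := fun x hx ↦ hx.2.le
    obtain ⟨ρ, hρ, hc, hm⟩ := exists_levy_law_charFun hν hexp2 0 hT.le hδ.1
      (A := A) (fun x hx ↦ hx.1)
    have hconv : P δ = (P ε).conv ρ := by
      refine Measure.ext_of_charFun (funext fun u ↦ ?_)
      have hunion : {x : EuclideanSpace ℝ (Fin d) | δ ≤ ‖x‖} = {x | ε ≤ ‖x‖} ∪ A := by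
        ext x
        simp only [A, Set.mem_ofPred_eq, Set.mem_union]
        grind
      have hdisj : Disjoint {x : EuclideanSpace ℝ (Fin d) | ε ≤ ‖x‖} A :=
        Set.disjoint_left.2 fun x (hx : ε ≤ ‖x‖) hx' ↦ hx.not_gt hx'.2
      have hint := integrable_levyIntegrand_I hν u
      rw [charFun_conv, hcharP δ hδ, hcharP ε hε, hc, ← Complex.exp_add, hunion,
        setIntegral_union hdisj hA hint.integrableOn hint.integrableOn]
      simp only [inner_zero_left, Complex.ofReal_zero]
      ring_nf
    have hY (j : Fin d) : Integrable (fun y ↦ |Real.exp (y j) - 1|) ρ ∧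
        ∫ y, |Real.exp (y j) - 1| ∂ρ ≤ Real.sqrt C₀ * Real.sqrt σ2 := by
      obtain ⟨h1, h1'⟩ := hm (e j) (by simp [hne])
      obtain ⟨h2, h2'⟩ := hm ((2 : ℝ) • e j) (hne2 j)
      simp only [he, he2, inner_zero_left, zero_add] at h1 h1' h2 h2'
      refine ⟨(h1.sub (integrable_const _)).abs, ?_⟩
      set κ := ∫ x in A, levyExpIntegrand ((2 : ℝ) • e j) x ∂ν
      have hge : 1 ≤ ∫ y : EuclideanSpace ℝ (Fin d), Real.exp (y j) ∂ρ := by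
        rw [h1']
        refine Real.one_le_exp (mul_nonneg hT.le (setIntegral_nonneg hA fun x hx ↦ ?_))
        exact levyExpIntegrand_nonneg ((hAε hx).trans hε.2)
      refine (integral_abs_exp_sub_one_le h1 h2 hge h2'.le).trans ?_
      rw [← Real.sqrt_mul (by positivity)]
      refine Real.sqrt_le_sqrt ?_
      have hκ1 : κ ≤ 2 ^ 2 * Real.exp 2 * σ2 :=
        setIntegral_levyExpIntegrand_le_of_subset hν (hne2 j) hε.2 hA hAε
      have hκ2 : κ ≤ K := (le_abs_self _).trans (hK _ (hne2 j) _)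
      calc T * κ * Real.exp (T * κ)
          ≤ T * (2 ^ 2 * Real.exp 2 * σ2) * Real.exp (T * K) := by gcongr
        _ = C₀ * σ2 := by ring
    rw [hconv]
    refine (abs_integral_conv_sub_le (clamp hF R).continuous.measurable (c := R)
      (p := fun j x ↦ Cf * Real.exp (x j)) (q := fun j y ↦ |Real.exp (y j) - 1|)
      (abs_clamp_le_natCast hF R) (fun j ↦ (hmom ε hε j).1.const_mul _) (fun j ↦ (hY j).1)
      (fun x y ↦ (abs_clamp_sub_clamp_le hF R _ _).trans
        (abs_expPayoff_add_sub_le hf x y))).trans ?_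
    calc _ ≤ ∑ _j : Fin d, (Cf * M) * (Real.sqrt C₀ * Real.sqrt σ2) := by
          refine Finset.sum_le_sum fun j _ ↦ mul_le_mul ?_ (hY j).2
            (integral_nonneg fun y ↦ abs_nonneg (Real.exp (y j) - 1)) (by positivity)
          rw [integral_const_mul]
          gcongr
          exact (hmom ε hε j).2
      _ = _ := by
          simp only [Finset.sum_const, Finset.card_univ, Fintype.card_fin, nsmul_eq_mul]
          ring
  have hPL : IsProbabilityMeasure (Measure.map L ℙ) := Measure.isProbabilityMeasure_map hmL
  let δ : ℕ → ℝ := fun n ↦ ε * (1 / (n + 1 : ℝ))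
  have hδ0 (n : ℕ) : 0 < δ n := mul_pos hε.1 (by positivity)
  have hδε (n : ℕ) : δ n ≤ ε :=
    mul_le_of_le_one_right hε.1.le (by rw [div_le_one (by positivity)]; simp)
  have hδ (n : ℕ) : δ n ∈ Set.Ioc (0 : ℝ) 1 := ⟨hδ0 n, (hδε n).trans hε.2⟩
  have hδanti : Antitone δ := fun m n hmn ↦ by
    have := hε.1
    simp only [δ]
    gcongr
  have hδlim : Filter.Tendsto δ Filter.atTop (nhds 0) := by
    simpa [δ] using (tendsto_one_div_add_atTop_nhds_zero_nat (𝕜 := ℝ)).const_mul ε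
  let μs : ℕ → ProbabilityMeasure (EuclideanSpace ℝ (Fin d)) := fun n ↦ ⟨P (δ n), hP _ (hδ n)⟩
  let μ : ProbabilityMeasure (EuclideanSpace ℝ (Fin d)) := ⟨Measure.map L ℙ, hPL⟩
  have hlim : Filter.Tendsto μs Filter.atTop (nhds μ) := by
    refine ProbabilityMeasure.tendsto_iff_tendsto_charFun.2 fun u ↦ ?_
    have hL : charFun (μ : Measure (EuclideanSpace ℝ (Fin d))) u =
        Complex.exp (T * (Complex.I * ((⟪γ, u⟫ : ℝ) : ℂ) +
          ∫ x, levyIntegrand Complex.I u x ∂ν)) :=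
      (charFun_map_eq_integral hmL u).trans (hcharL u)
    rw [hL]
    refine Filter.Tendsto.congr (fun n ↦ (hcharP (δ n) (hδ n) u).symm) ?_
    exact (((tendsto_setIntegral_levyIntegrand hν u hδanti hδlim).const_add _).const_mul _).cexp
  have hgμ : Integrable g (μ : Measure (EuclideanSpace ℝ (Fin d))) :=
    integrable_of_tendsto_of_integral_le hlim hg hg0 (fun n ↦ hgi _ (hδ n)) fun n ↦ hgM _ (hδ n)
  have hmain := abs_integral_sub_integral_le_of_tendsto hlim hF (hFi hgμ) (hFi (hgi ε hε))
    fun R n ↦ hcompare (δ n) (hδ n) (hδε n) R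
  have e1 : ∫ x, F x ∂(μ : Measure (EuclideanSpace ℝ (Fin d))) = ∫ ω, F (L ω) :=
    integral_map hmL hF.measurable.aestronglyMeasurable
  have e2 : ∫ x, F x ∂(P ε) = ∫ ω, F (Lε ε ω) :=
    integral_map (hmLε ε hε) hF.measurable.aestronglyMeasurable
  rw [e1, e2] at hmain
  refine hmain.trans ?_
  gcongr
  linarith
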